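/- Let A be a nonzero m×n real matrix and θ > 0, and let X be feasible for the problem: maximize ⟨A,X⟩ subject to ‖X‖_θ ≤ 1, and let (Y,Z) satisfy Y + Z = A. Then ⟨A,X⟩ ≤ max{‖Y‖, θ⁻¹‖Z‖_∞} (weak duality). -/

import Mathlib

open scoped BigOperators

noncomputable section

namespace LAROS

variable {m n : ℕ}

/-- Trace inner product `⟨A,X⟩ = trace(Aᵀ X)`. -/
def mInner (A X : Matrix (Fin m) (Fin n) ℝ) : ℝ := ∑ i, ∑ j, A i j * X i j

/-- `N` is a norm on `m×n` real matrices. -/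
def IsMatrixNorm (N : Matrix (Fin m) (Fin n) ℝ → ℝ) : Prop :=
  (∀ X, N X = 0 ↔ X = 0) ∧ (∀ (c : ℝ) (X), N (c • X) = |c| * N X) ∧
    (∀ X Y, N (X + Y) ≤ N X + N Y)

/-- Dual norm of `N`. -/
def dualNorm (N : Matrix (Fin m) (Fin n) ℝ → ℝ) (A : Matrix (Fin m) (Fin n) ℝ) : ℝ :=
  sSup {r | ∃ Y, N Y ≤ 1 ∧ r = mInner A Y}

/-- `X` is optimal for: minimize `N X` subject to `⟨A,X⟩ ≥ 1`. -/
def IsOptMin (N : Matrix (Fin m) (Fin n) ℝ → ℝ) (A X : Matrix (Fin m) (Fin n) ℝ) : Prop :=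
  1 ≤ mInner A X ∧ ∀ X', 1 ≤ mInner A X' → N X ≤ N X'

/-- `Y` is optimal for: maximize `⟨A,Y⟩` subject to `N Y ≤ 1`. -/
def IsOptMax (N : Matrix (Fin m) (Fin n) ℝ → ℝ) (A Y : Matrix (Fin m) (Fin n) ℝ) : Prop :=
  N Y ≤ 1 ∧ ∀ Y', N Y' ≤ 1 → mInner A Y' ≤ mInner A Y

/-- Subdifferential of `f : ℝ^{m×n} → ℝ` at `A`, with respect to the trace inner product. -/
def subdiff (f : Matrix (Fin m) (Fin n) ℝ → ℝ) (A : Matrix (Fin m) (Fin n) ℝ) :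
    Set (Matrix (Fin m) (Fin n) ℝ) :=
  {Y | ∀ B, f A + mInner (B - A) Y ≤ f B}

/-- The spectral norm (largest singular value) of an `m×n` real matrix. -/
def spectralNorm (A : Matrix (Fin m) (Fin n) ℝ) : ℝ :=
  sSup {r | ∃ (u : Fin m → ℝ) (v : Fin n → ℝ),
    (∑ i, u i ^ 2) ≤ 1 ∧ (∑ j, v j ^ 2) ≤ 1 ∧ r = ∑ i, ∑ j, u i * A i j * v j}

/-- The nuclear norm (sum of singular values), as the dual norm of the spectral norm. -/
def nuclearNorm (A : Matrix (Fin m) (Fin n) ℝ) : ℝ := dualNorm spectralNorm A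

/-- Entrywise ℓ1 norm: sum of absolute values of all entries. -/
def l1Norm (X : Matrix (Fin m) (Fin n) ℝ) : ℝ := ∑ i, ∑ j, |X i j|

/-- Entrywise max norm: maximum absolute value of an entry. -/
def maxNorm (X : Matrix (Fin m) (Fin n) ℝ) : ℝ := sSup {r | ∃ i j, r = |X i j|}

/-- The norm `‖X‖_θ = ‖X‖_* + θ‖X‖₁`. -/
def thetaNorm (θ : ℝ) (X : Matrix (Fin m) (Fin n) ℝ) : ℝ := nuclearNorm X + θ * l1Norm X

/-- The bilinear form `uᵀ A v` over the unit balls is bounded by the entrywise ℓ1 norm. -/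
lemma bilin_le_l1Norm (A : Matrix (Fin m) (Fin n) ℝ) {u : Fin m → ℝ} {v : Fin n → ℝ}
    (hu : ∑ i, u i ^ 2 ≤ 1) (hv : ∑ j, v j ^ 2 ≤ 1) :
    ∑ i, ∑ j, u i * A i j * v j ≤ l1Norm A := by
  refine Finset.sum_le_sum fun i _ => Finset.sum_le_sum fun j _ => ?_
  have hui : |u i| ≤ 1 := (sq_le_one_iff_abs_le_one _).1 <|
    (Finset.single_le_sum (f := fun i => u i ^ 2) (fun _ _ => sq_nonneg _)
      (Finset.mem_univ i)).trans hu
  have hvj : |v j| ≤ 1 := (sq_le_one_iff_abs_le_one _).1 <|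
    (Finset.single_le_sum (f := fun j => v j ^ 2) (fun _ _ => sq_nonneg _)
      (Finset.mem_univ j)).trans hv
  calc u i * A i j * v j ≤ |u i * A i j * v j| := le_abs_self _
    _ = |u i| * |A i j| * |v j| := by rw [abs_mul, abs_mul]
    _ ≤ 1 * |A i j| * 1 := by gcongr
    _ = |A i j| := by ring

lemma bilin_le_spectralNorm (A : Matrix (Fin m) (Fin n) ℝ) {u : Fin m → ℝ} {v : Fin n → ℝ}
    (hu : ∑ i, u i ^ 2 ≤ 1) (hv : ∑ j, v j ^ 2 ≤ 1) :
    ∑ i, ∑ j, u i * A i j * v j ≤ spectralNorm A := by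
  refine le_csSup ⟨l1Norm A, ?_⟩ ⟨u, v, hu, hv, rfl⟩
  rintro r ⟨u, v, hu, hv, rfl⟩
  exact bilin_le_l1Norm A hu hv

lemma spectralNorm_le {A : Matrix (Fin m) (Fin n) ℝ} {c : ℝ}
    (h : ∀ (u : Fin m → ℝ) (v : Fin n → ℝ), ∑ i, u i ^ 2 ≤ 1 → ∑ j, v j ^ 2 ≤ 1 →
      ∑ i, ∑ j, u i * A i j * v j ≤ c) : spectralNorm A ≤ c := by
  refine csSup_le ⟨_, 0, 0, by simp, by simp, rfl⟩ ?_
  rintro r ⟨u, v, hu, hv, rfl⟩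
  exact h u v hu hv

lemma spectralNorm_nonneg (A : Matrix (Fin m) (Fin n) ℝ) : 0 ≤ spectralNorm A := by
  simpa using bilin_le_spectralNorm A (u := 0) (v := 0) (by simp) (by simp)

lemma abs_apply_le_spectralNorm (A : Matrix (Fin m) (Fin n) ℝ) (i : Fin m) (j : Fin n) :
    |A i j| ≤ spectralNorm A := by
  have key : ∀ c : ℝ, c ^ 2 = 1 → c * A i j ≤ spectralNorm A := fun c hc => by
    simpa [Pi.single_apply] using
      bilin_le_spectralNorm A (u := Pi.single i c) (v := Pi.single j 1)
        (by simp [Pi.single_apply, hc]) (by simp [Pi.single_apply])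
  refine abs_le'.2 ⟨?_, ?_⟩
  · simpa using key 1 (by norm_num)
  · simpa using key (-1) (by norm_num)

lemma mInner_comm (A X : Matrix (Fin m) (Fin n) ℝ) : mInner A X = mInner X A := by
  simp only [mInner, mul_comm]

lemma mInner_add_left (A B X : Matrix (Fin m) (Fin n) ℝ) :
    mInner (A + B) X = mInner A X + mInner B X := by
  simp only [mInner, Matrix.add_apply, add_mul, Finset.sum_add_distrib]

lemma mInner_smul_left (c : ℝ) (A X : Matrix (Fin m) (Fin n) ℝ) :
    mInner (c • A) X = c * mInner A X := by
  simp only [mInner, Matrix.smul_apply, smul_eq_mul, mul_assoc, Finset.mul_sum]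

lemma mInner_le_mul_l1Norm {A : Matrix (Fin m) (Fin n) ℝ} {c : ℝ} (h : ∀ i j, |A i j| ≤ c)
    (X : Matrix (Fin m) (Fin n) ℝ) : mInner A X ≤ c * l1Norm X := by
  simp only [mInner, l1Norm, Finset.mul_sum]
  refine Finset.sum_le_sum fun i _ => Finset.sum_le_sum fun j _ => ?_
  calc A i j * X i j ≤ |A i j * X i j| := le_abs_self _
    _ = |A i j| * |X i j| := abs_mul _ _
    _ ≤ c * |X i j| := by gcongr; exact h i j

lemma l1Norm_nonneg (X : Matrix (Fin m) (Fin n) ℝ) : 0 ≤ l1Norm X :=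
  Finset.sum_nonneg fun _ _ => Finset.sum_nonneg fun _ _ => abs_nonneg _

lemma mInner_le_nuclearNorm (X : Matrix (Fin m) (Fin n) ℝ) {Y : Matrix (Fin m) (Fin n) ℝ}
    (hY : spectralNorm Y ≤ 1) : mInner X Y ≤ nuclearNorm X := by
  refine le_csSup ⟨1 * l1Norm X, ?_⟩ ⟨Y, hY, rfl⟩
  rintro r ⟨W, hW, rfl⟩
  rw [mInner_comm]
  exact mInner_le_mul_l1Norm (fun i j => (abs_apply_le_spectralNorm W i j).trans hW) X

lemma nuclearNorm_nonneg (X : Matrix (Fin m) (Fin n) ℝ) : 0 ≤ nuclearNorm X := by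
  have h : spectralNorm (0 : Matrix (Fin m) (Fin n) ℝ) ≤ 1 := spectralNorm_le (by simp)
  simpa [mInner] using mInner_le_nuclearNorm X h

/-- Hölder inequality for the spectral and nuclear norms. -/
lemma mInner_le_spectralNorm_mul_nuclearNorm (Y X : Matrix (Fin m) (Fin n) ℝ) :
    mInner Y X ≤ spectralNorm Y * nuclearNorm X := by
  rcases (spectralNorm_nonneg Y).eq_or_lt with h0 | hpos
  · rw [← h0, zero_mul, ← zero_mul (l1Norm X), h0]
    exact mInner_le_mul_l1Norm (abs_apply_le_spectralNorm Y) X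
  · have hle : spectralNorm ((spectralNorm Y)⁻¹ • Y) ≤ 1 := by
      refine spectralNorm_le fun u v hu hv => ?_
      calc ∑ i, ∑ j, u i * ((spectralNorm Y)⁻¹ • Y) i j * v j
          = (spectralNorm Y)⁻¹ * ∑ i, ∑ j, u i * Y i j * v j := by
            simp only [Matrix.smul_apply, smul_eq_mul, Finset.mul_sum]
            exact Finset.sum_congr rfl fun i _ => Finset.sum_congr rfl fun j _ => by ring
        _ ≤ (spectralNorm Y)⁻¹ * spectralNorm Y := by
            gcongr
            exact bilin_le_spectralNorm Y hu hv
        _ = 1 := inv_mul_cancel₀ hpos.ne'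
    have h := mInner_le_nuclearNorm X hle
    rwa [mInner_comm, mInner_smul_left, inv_mul_le_iff₀ hpos] at h

lemma abs_apply_le_maxNorm (Z : Matrix (Fin m) (Fin n) ℝ) (i : Fin m) (j : Fin n) :
    |Z i j| ≤ maxNorm Z := by
  refine le_csSup ⟨spectralNorm Z, ?_⟩ ⟨i, j, rfl⟩
  rintro r ⟨i, j, rfl⟩
  exact abs_apply_le_spectralNorm Z i j

theorem stmt9 (θ : ℝ) (hθ : 0 < θ) (A : Matrix (Fin m) (Fin n) ℝ) (hA : A ≠ 0)
    (X Y Z : Matrix (Fin m) (Fin n) ℝ)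
    (hXfeas : thetaNorm θ X ≤ 1) (hYZ : Y + Z = A) :
    mInner A X ≤ max (spectralNorm Y) (θ⁻¹ * maxNorm Z) := by
  set M := max (spectralNorm Y) (θ⁻¹ * maxNorm Z)
  have hM : 0 ≤ M := (spectralNorm_nonneg Y).trans (le_max_left _ _)
  have hZ : maxNorm Z ≤ M * θ := by
    rw [mul_comm, ← inv_mul_le_iff₀ hθ]
    exact le_max_right _ _
  calc mInner A X = mInner Y X + mInner Z X := by rw [← hYZ, mInner_add_left]
    _ ≤ spectralNorm Y * nuclearNorm X + maxNorm Z * l1Norm X :=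
        add_le_add (mInner_le_spectralNorm_mul_nuclearNorm Y X)
          (mInner_le_mul_l1Norm (abs_apply_le_maxNorm Z) X)
    _ ≤ M * nuclearNorm X + M * θ * l1Norm X :=
        add_le_add (mul_le_mul_of_nonneg_right (le_max_left _ _) (nuclearNorm_nonneg X))
          (mul_le_mul_of_nonneg_right hZ (l1Norm_nonneg X))
    _ = M * thetaNorm θ X := by rw [thetaNorm]; ring
    _ ≤ M := mul_le_of_le_one_right hM hXfeas

end LAROS
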